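/- Let H be a Hilbert space with orthonormal basis (e_λ)_{λ ∈ Λ}, Λ ⊂ [0,∞) countable. Suppose the spectral projectors Π_k u = Σ_{λ∈Λ∩[k,k+1)} u_λ e_λ satisfy ‖Π_k u‖_{L^q(Ω)} ≤ C(1+k)^δ ‖Π_k u‖_H for all k ∈ ℕ (with H ⊂ L²(Ω)). Then for A defined by A e_λ = ⌊λ⌋ e_λ and s = 1/2 − 1/q with q ≥ 2, the propagator satisfies ‖e^{itA}u₀‖_{L^q((0,2π)×Ω)} ≤ C' ‖u₀‖_{H^{δ+1/2−1/q}} where ‖u₀‖²_{H^σ} = Σ_λ (1+λ)^{2σ}|u_λ|². -/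

import Mathlib

open MeasureTheory Set Real

lemma aux_exp_int (m : ℤ) : ∫ t in (0:ℝ)..(2*π), Complex.exp (Complex.I * t * m) = if m = 0 then (2*π : ℂ) else 0 := by
  split_ifs with h
  · subst h; simp
  · have hc : Complex.I * (m:ℂ) ≠ 0 := by simp [h]
    have := integral_exp_mul_complex (a := 0) (b := 2*π) hc
    calc _ = ∫ t in (0:ℝ)..(2*π), Complex.exp (Complex.I * m * t) := by
          congr 1; ext t; congr 1; ring
      _ = _ := by
          rw [this]
          have : Complex.exp (Complex.I * m * ((2 * π : ℝ):ℂ)) = 1 := by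
            rw [Complex.exp_eq_one_iff]
            exact ⟨m, by push_cast; ring⟩
          rw [this]; simp

lemma aux_planch_fin (b : ℕ → ℂ) (s : Finset ℕ) :
    ∫ t in (0:ℝ)..(2*π), ‖∑ k ∈ s, b k * Complex.exp (Complex.I * t * k)‖^2 = 2*π*∑ k ∈ s, ‖b k‖^2 := by
  apply Complex.ofReal_injective
  rw [← intervalIntegral.integral_ofReal]
  have h1 : ∀ t : ℝ, ((‖∑ k ∈ s, b k * Complex.exp (Complex.I * t * k)‖^2 : ℝ) : ℂ) =
      ∑ j ∈ s, ∑ k ∈ s, (b j * (starRingEnd ℂ) (b k)) * Complex.exp (Complex.I * t * ((j - k : ℤ):ℂ)) := by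
    intro t
    push_cast
    rw [← Complex.mul_conj', map_sum, Finset.sum_mul_sum]
    refine Finset.sum_congr rfl fun j _ => Finset.sum_congr rfl fun k _ => ?_
    rw [map_mul, ← Complex.exp_conj]
    simp only [map_mul, Complex.conj_I, Complex.conj_ofReal, map_natCast]
    rw [mul_mul_mul_comm, ← Complex.exp_add]
    congr 2; ring
  simp_rw [h1]
  rw [intervalIntegral.integral_finsetSum]
  swap
  · intro i _
    exact Continuous.intervalIntegrable (by fun_prop) _ _
  push_cast
  rw [Finset.mul_sum]
  refine Finset.sum_congr rfl fun j hj => ?_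
  rw [intervalIntegral.integral_finsetSum]
  swap
  · intro i _
    exact Continuous.intervalIntegrable (by fun_prop) _ _
  simp_rw [intervalIntegral.integral_const_mul]
  have := fun k : ℕ => aux_exp_int (j - k)
  push_cast at this
  simp_rw [this]
  rw [Finset.sum_eq_single j]
  · simp [Complex.mul_conj']; ring
  · intro k _ hk
    rw [if_neg (by omega), mul_zero]
  · intro h; exact absurd hj h

lemma aux_norm_term (b : ℂ) (t : ℝ) (k : ℕ) : ‖b * Complex.exp (Complex.I * t * k)‖ = ‖b‖ := by
  have : Complex.I * t * (k:ℂ) = ((t * k : ℝ) : ℂ) * Complex.I := by push_cast; ring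
  rw [norm_mul, this, Complex.norm_exp_ofReal_mul_I, mul_one]

lemma aux_summ {b : ℕ → ℂ} (hb : Summable fun k => ‖b k‖) (t : ℝ) :
    Summable fun k : ℕ => b k * Complex.exp (Complex.I * t * k) := by
  apply Summable.of_norm
  simpa only [aux_norm_term] using hb

lemma aux_cont {b : ℕ → ℂ} (hb : Summable fun k => ‖b k‖) :
    Continuous fun t : ℝ => ∑' k : ℕ, b k * Complex.exp (Complex.I * t * k) := by
  refine continuous_tsum (fun k => by fun_prop) hb fun k t => ?_
  rw [aux_norm_term]

lemma aux_planch {b : ℕ → ℂ} (hb : Summable fun k => ‖b k‖) :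
    ∫⁻ t in Ioo (0:ℝ) (2*π), ‖∑' k : ℕ, b k * Complex.exp (Complex.I * t * k)‖ₑ^2
      ≤ ENNReal.ofReal (2*π) * ∑' k, ‖b k‖ₑ^2 := by
  have hfin : ∀ n : ℕ, ∫⁻ t in Ioo (0:ℝ) (2*π), ‖∑ k ∈ Finset.range n, b k * Complex.exp (Complex.I * t * k)‖ₑ^2
      ≤ ENNReal.ofReal (2*π) * ∑' k, ‖b k‖ₑ^2 := by
    intro n
    have h := aux_planch_fin b (Finset.range n)
    rw [intervalIntegral.integral_of_le (by positivity), integral_Ioc_eq_integral_Ioo] at h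
    have h2 : ∀ z : ℂ, ‖z‖ₑ^2 = ENNReal.ofReal (‖z‖^2) := by
      intro z; rw [ENNReal.ofReal_pow (norm_nonneg _), ofReal_norm]
    simp_rw [h2]
    rw [← ofReal_integral_eq_lintegral_ofReal, h, ENNReal.ofReal_mul (by positivity),
      ENNReal.ofReal_sum_of_nonneg (fun _ _ => by positivity)]
    · gcongr
      exact ENNReal.sum_le_tsum _
    · refine IntegrableOn.mono_set ?_ Ioo_subset_Icc_self
      exact Continuous.integrableOn_Icc (by fun_prop)
    · exact Filter.Eventually.of_forall fun _ => by positivity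
  have hl : ∀ t : ℝ, Filter.Tendsto (fun n => ‖∑ k ∈ Finset.range n, b k * Complex.exp (Complex.I * t * k)‖ₑ^2)
      Filter.atTop (nhds (‖∑' k : ℕ, b k * Complex.exp (Complex.I * t * k)‖ₑ^2)) := by
    intro t
    have := (aux_summ hb t).hasSum.tendsto_sum_nat
    exact ENNReal.Tendsto.pow this.enorm
  calc _ = ∫⁻ t in Ioo (0:ℝ) (2*π), Filter.liminf (fun n => ‖∑ k ∈ Finset.range n, b k * Complex.exp (Complex.I * t * k)‖ₑ^2) Filter.atTop := by
        simp_rw [fun t => (hl t).liminf_eq]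
    _ ≤ Filter.liminf (fun n => ∫⁻ t in Ioo (0:ℝ) (2*π), ‖∑ k ∈ Finset.range n, b k * Complex.exp (Complex.I * t * k)‖ₑ^2) Filter.atTop :=
        lintegral_liminf_le fun n => by fun_prop
    _ ≤ _ := Filter.liminf_le_of_frequently_le' (Filter.Frequently.of_forall hfin)

lemma aux_sum_bd {a : ℝ} (ha : 0 < a) (ha1 : a ≤ 1) (n : ℕ) :
    ∑ k ∈ Finset.range n, (1 + (k:ℝ)) ^ (a - 1) ≤ (n:ℝ) ^ a / a := by
  induction n with
  | zero => simp [Real.zero_rpow ha.ne']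
  | succ n ih =>
    rw [Finset.sum_range_succ]
    have hn : (0:ℝ) < 1 + n := by positivity
    have hB := rpow_one_add_le_one_add_mul_self (s := -(1/(1+(n:ℝ)))) 
      (by rw [neg_le_neg_iff, div_le_one hn]; linarith [(Nat.cast_nonneg n : (0:ℝ) ≤ n)]) ha.le ha1
    have h1 : 1 + -(1/(1+(n:ℝ))) = n / (1+n) := by field_simp; ring
    rw [h1, Real.div_rpow (by positivity) hn.le, div_le_iff₀ (by positivity)] at hB
    have h2 : (1 + (n:ℝ))^(a-1) = (1+(n:ℝ))^a / (1+n) := by rw [Real.rpow_sub hn, Real.rpow_one]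
    rw [h2]
    push_cast
    rw [add_comm (n:ℝ) 1]
    have h3 : (1 + a * -(1/(1+(n:ℝ)))) * (1+(n:ℝ))^a = (1+(n:ℝ))^a - a * ((1+(n:ℝ))^a/(1+n)) := by ring
    rw [h3] at hB
    rw [le_div_iff₀ ha] at ih ⊢
    nlinarith

lemma aux_low {b : ℕ → ℂ} {q N l : ℝ} (hq : 2 ≤ q) (hN : 0 < N) (hl : 0 < l)
    (hbN : ∀ n, ∑ k ∈ Finset.range n, (1 + (k:ℝ)) ^ (1 - 2/q) * ‖b k‖^2 ≤ N^2) (n : ℕ) :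
    ∑ k ∈ Finset.range n, ‖if l < 2 * √(q/2) * N * (1 + (k:ℝ))^(1/q) then 0 else b k‖ ≤ l/2 := by
  induction n with
  | zero => simp; positivity
  | succ n ih =>
    by_cases h : l < 2 * √(q/2) * N * (1 + (n:ℝ))^(1/q)
    · rw [Finset.sum_range_succ, if_pos h]; simpa using ih
    · push Not at h
      have hq0 : 0 < q := by linarith
      have h1 : ∑ k ∈ Finset.range (n+1), ‖if l < 2 * √(q/2) * N * (1 + (k:ℝ))^(1/q) then 0 else b k‖
          ≤ ∑ k ∈ Finset.range (n+1), (1+(k:ℝ))^((2/q-1)/2) * ((1+(k:ℝ))^((1-2/q)/2) * ‖b k‖) := by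
        refine Finset.sum_le_sum fun k _ => ?_
        have hk : (0:ℝ) < 1 + k := by positivity
        rw [← mul_assoc, ← Real.rpow_add hk, show (2/q-1)/2 + (1-2/q)/2 = 0 by ring, Real.rpow_zero, one_mul]
        split_ifs <;> simp
      have h2 := Finset.sum_mul_sq_le_sq_mul_sq (Finset.range (n+1)) (fun k : ℕ => (1+(k:ℝ))^((2/q-1)/2))
        (fun k => (1+(k:ℝ))^((1-2/q)/2) * ‖b k‖)
      have hsq : ∀ (k : ℕ) (x : ℝ), ((1+(k:ℝ))^(x/2))^2 = (1+(k:ℝ))^x := by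
        intro k x
        rw [← Real.rpow_natCast, ← Real.rpow_mul (by positivity)]; congr 1; push_cast; ring
      simp_rw [mul_pow, hsq] at h2
      have h3 := aux_sum_bd (a := 2/q) (by positivity) (by rw [div_le_one hq0]; exact hq) (n+1)
      have h4 := hbN (n+1)
      have h5 : (∑ k ∈ Finset.range (n+1), (1+(k:ℝ))^(2/q-1)) * (∑ k ∈ Finset.range (n+1), (1 + (k:ℝ)) ^ (1 - 2/q) * ‖b k‖^2)
          ≤ ((n+1:ℕ):ℝ)^(2/q)/(2/q) * N^2 := by
        apply mul_le_mul h3 h4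
        · exact Finset.sum_nonneg fun _ _ => by positivity
        · positivity
      have h6 : ((n+1:ℕ):ℝ)^(2/q)/(2/q) * N^2 = (√(q/2) * N * (1 + (n:ℝ))^(1/q))^2 := by
        rw [mul_pow, mul_pow, Real.sq_sqrt (by positivity), ← Real.rpow_natCast ((1 + (n:ℝ))^(1/q)), ← Real.rpow_mul (by positivity)]
        push_cast
        rw [add_comm (n:ℝ) 1, show 1/q*2 = 2/q by ring]
        field_simp
      have h7 := abs_le_of_sq_le_sq (h2.trans (h5.trans_eq h6)) (by positivity)
      have := le_abs_self (∑ k ∈ Finset.range (n+1), (1+(k:ℝ))^((2/q-1)/2) * ((1+(k:ℝ))^((1-2/q)/2) * ‖b k‖))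
      linarith

lemma aux_level {b : ℕ → ℂ} (hb : Summable fun k => ‖b k‖) {q N l : ℝ} (hq : 2 ≤ q) (hN : 0 < N) (hl : 0 < l)
    (hbN : ∀ n, ∑ k ∈ Finset.range n, (1 + (k:ℝ)) ^ (1 - 2/q) * ‖b k‖^2 ≤ N^2) :
    (volume.restrict (Ioo (0:ℝ) (2*π))) {t | l < ‖∑' k : ℕ, b k * Complex.exp (Complex.I * t * k)‖}
      ≤ ENNReal.ofReal (8*π*l^(-2:ℝ)) * ∑' k : ℕ, if l < 2 * √(q/2) * N * (1 + (k:ℝ))^(1/q) then ‖b k‖ₑ^2 else 0 := by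
  set bl : ℕ → ℂ := fun k => if l < 2 * √(q/2) * N * (1 + (k:ℝ))^(1/q) then 0 else b k with hbl
  set bh : ℕ → ℂ := fun k => if l < 2 * √(q/2) * N * (1 + (k:ℝ))^(1/q) then b k else 0 with hbh
  have hbls : Summable fun k => ‖bl k‖ := by
    refine Summable.of_nonneg_of_le (fun _ => norm_nonneg _) (fun k => ?_) hb
    simp only [hbl]; split_ifs <;> simp
  have hbhs : Summable fun k => ‖bh k‖ := by
    refine Summable.of_nonneg_of_le (fun _ => norm_nonneg _) (fun k => ?_) hb
    simp only [hbh]; split_ifs <;> simp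
  have hlow : ∀ t : ℝ, ‖∑' k : ℕ, bl k * Complex.exp (Complex.I * t * k)‖ ≤ l/2 := by
    intro t
    refine (norm_tsum_le_tsum_norm ?_).trans ?_
    · simpa only [aux_norm_term] using hbls
    · simp_rw [aux_norm_term]
      exact Real.tsum_le_of_sum_range_le (fun _ => norm_nonneg _) (fun n => aux_low hq hN hl hbN n)
  have hsplit : ∀ t : ℝ, ∑' k : ℕ, b k * Complex.exp (Complex.I * t * k) =
      ∑' k : ℕ, bl k * Complex.exp (Complex.I * t * k) + ∑' k : ℕ, bh k * Complex.exp (Complex.I * t * k) := by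
    intro t
    rw [← (aux_summ hbls t).tsum_add (aux_summ hbhs t)]
    congr 1; ext k
    simp only [hbl, hbh]; split_ifs <;> simp
  have hsub : {t : ℝ | l < ‖∑' k : ℕ, b k * Complex.exp (Complex.I * t * k)‖} ⊆
      {t : ℝ | ENNReal.ofReal ((l/2)^2) ≤ ‖∑' k : ℕ, bh k * Complex.exp (Complex.I * t * k)‖ₑ^2} := by
    intro t ht
    simp only [mem_ofPred_eq] at ht ⊢
    rw [hsplit] at ht
    have h1 := norm_add_le (∑' k : ℕ, bl k * Complex.exp (Complex.I * t * k)) (∑' k : ℕ, bh k * Complex.exp (Complex.I * t * k))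
    have h2 := hlow t
    rw [ENNReal.ofReal_pow (by positivity), ← ofReal_norm]
    gcongr
    linarith
  have hmeas : Measurable fun t : ℝ => ‖∑' k : ℕ, bh k * Complex.exp (Complex.I * t * k)‖ₑ^2 :=
    ((aux_cont hbhs).measurable.enorm).pow_const 2
  have hcheb := mul_meas_ge_le_lintegral (μ := volume.restrict (Ioo (0:ℝ) (2*π))) hmeas (ENNReal.ofReal ((l/2)^2))
  have hP := hcheb.trans (aux_planch hbhs)
  have hsum : ∑' k : ℕ, ‖bh k‖ₑ^2 = ∑' k : ℕ, if l < 2 * √(q/2) * N * (1 + (k:ℝ))^(1/q) then ‖b k‖ₑ^2 else 0 := by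
    congr 1; ext k; simp only [hbh]; split_ifs <;> simp
  rw [hsum] at hP
  refine (measure_mono hsub).trans ?_
  have hc : ENNReal.ofReal (8*π*l^(-2:ℝ)) = (ENNReal.ofReal ((l/2)^2))⁻¹ * ENNReal.ofReal (2*π) := by
    rw [← ENNReal.ofReal_inv_of_pos (by positivity), ← ENNReal.ofReal_mul (by positivity)]
    congr 1
    rw [Real.rpow_neg hl.le]
    norm_num
    field_simp
    norm_num
  rw [hc, mul_assoc, ← ENNReal.div_eq_inv_mul, ENNReal.le_div_iff_mul_le, mul_comm]
  · exact hP
  · left; simp; positivity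
  · left; simp

lemma aux_int_pow {r M : ℝ} (hr : -1 < r) (hM : 0 ≤ M) :
    ∫⁻ l in Ioi (0:ℝ), (if l < M then ENNReal.ofReal (l^r) else 0) ≤ ENNReal.ofReal (M^(r+1)/(r+1)) := by
  have h1 : ∀ l : ℝ, (if l < M then ENNReal.ofReal (l^r) else 0) = (Iio M).indicator (fun l => ENNReal.ofReal (l^r)) l := by
    intro l; simp [indicator]
  simp_rw [h1]
  rw [lintegral_indicator measurableSet_Iio, Measure.restrict_restrict measurableSet_Iio]
  have h2 : Iio M ∩ Ioi 0 = Ioo 0 M := by ext; simp [and_comm]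
  rw [h2, ← ofReal_integral_eq_lintegral_ofReal, ← integral_Ioc_eq_integral_Ioo, ← intervalIntegral.integral_of_le hM,
    integral_rpow (Or.inl hr), Real.zero_rpow (by linarith), sub_zero]
  · have := intervalIntegral.intervalIntegrable_rpow' (a := 0) (b := M) hr
    rw [intervalIntegrable_iff_integrableOn_Ioo_of_le hM] at this
    exact this
  · filter_upwards [ae_restrict_mem measurableSet_Ioo] with x hx
    exact Real.rpow_nonneg hx.1.le _

lemma aux_sob_real {b : ℕ → ℂ} (hb : Summable fun k => ‖b k‖) {q N : ℝ} (hq : 2 < q) (hN : 0 < N)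
    (hbN : ∑' k : ℕ, ENNReal.ofReal ((1 + (k:ℝ)) ^ (1 - 2/q)) * ‖b k‖ₑ^2 ≤ ENNReal.ofReal (N^2)) :
    ∫⁻ t in Ioo (0:ℝ) (2*π), ‖∑' k : ℕ, b k * Complex.exp (Complex.I * t * k)‖ₑ^q
      ≤ ENNReal.ofReal (q * (8*π) * ((2*√(q/2))^(q-2) / (q-2))) * ENNReal.ofReal (N^q) := by
  have hq0 : 0 < q := by linarith
  have hq2 : 0 < q - 2 := by linarith
  have hterm : ∀ k : ℕ, ENNReal.ofReal ((1 + (k:ℝ)) ^ (1 - 2/q)) * ‖b k‖ₑ^2 = ENNReal.ofReal ((1 + (k:ℝ)) ^ (1 - 2/q) * ‖b k‖^2) := by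
    intro k
    rw [ENNReal.ofReal_mul (by positivity), ENNReal.ofReal_pow (norm_nonneg _), ofReal_norm]
  have hbN' : ∀ n, ∑ k ∈ Finset.range n, (1 + (k:ℝ)) ^ (1 - 2/q) * ‖b k‖^2 ≤ N^2 := by
    intro n
    rw [← ENNReal.ofReal_le_ofReal_iff (by positivity), ENNReal.ofReal_sum_of_nonneg (fun _ _ => by positivity)]
    refine le_trans ?_ hbN
    simp_rw [hterm]
    exact ENNReal.sum_le_tsum _
  have h0 : ∀ t : ℝ, ‖∑' k : ℕ, b k * Complex.exp (Complex.I * t * k)‖ₑ^q = ENNReal.ofReal (‖∑' k : ℕ, b k * Complex.exp (Complex.I * t * k)‖^q) := by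
    intro t
    rw [← ENNReal.ofReal_rpow_of_nonneg (norm_nonneg _) hq0.le, ofReal_norm]
  simp_rw [h0]
  rw [lintegral_rpow_eq_lintegral_meas_lt_mul _ (Filter.Eventually.of_forall fun _ => norm_nonneg _)
    (aux_cont hb).norm.measurable.aemeasurable hq0]
  set M : ℕ → ℝ := fun k => 2 * √(q/2) * N * (1 + (k:ℝ))^(1/q) with hM
  calc _ ≤ ENNReal.ofReal q * ∫⁻ l in Ioi (0:ℝ), ENNReal.ofReal (8*π) * ∑' k : ℕ, ‖b k‖ₑ^2 * (if l < M k then ENNReal.ofReal (l^(q-3)) else 0) := by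
        gcongr ENNReal.ofReal q * ?_
        refine setLIntegral_mono' measurableSet_Ioi fun l hl => ?_
        have hl : 0 < l := hl
        refine (mul_le_mul_left (aux_level hb hq.le hN hl hbN') _).trans_eq ?_
        rw [mul_right_comm, ← ENNReal.ofReal_mul (by positivity), mul_assoc (8*π), ← Real.rpow_add hl,
          show (-2:ℝ) + (q-1) = q - 3 by ring, ENNReal.ofReal_mul (by positivity), mul_assoc, ← ENNReal.tsum_mul_left]
        refine congrArg _ (tsum_congr fun k => ?_)
        simp only [hM]
        split_ifs
        · rw [mul_comm]
        · simp
    _ = ENNReal.ofReal q * (ENNReal.ofReal (8*π) * ∑' k : ℕ, ‖b k‖ₑ^2 * ∫⁻ l in Ioi (0:ℝ), (if l < M k then ENNReal.ofReal (l^(q-3)) else 0)) := by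
        have hm : ∀ k, Measurable fun l : ℝ => (if l < M k then ENNReal.ofReal (l^(q-3)) else 0) := fun k =>
          Measurable.ite measurableSet_Iio (by fun_prop) measurable_const
        rw [lintegral_const_mul _ (Measurable.tsum fun k => (hm k).const_mul _),
          lintegral_tsum (fun k => ((hm k).const_mul _).aemeasurable)]
        simp_rw [fun k => lintegral_const_mul (μ := volume.restrict (Ioi (0:ℝ))) (‖b k‖ₑ^2) (hm k)]
    _ ≤ ENNReal.ofReal q * (ENNReal.ofReal (8*π) * ∑' k : ℕ, ‖b k‖ₑ^2 * (ENNReal.ofReal ((2*√(q/2))^(q-2) / (q-2) * N^(q-2)) * ENNReal.ofReal ((1 + (k:ℝ)) ^ (1 - 2/q)))) := by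
        gcongr with k
        refine (aux_int_pow (by linarith) (by simp only [hM]; positivity)).trans_eq ?_
        rw [← ENNReal.ofReal_mul (by positivity)]
        congr 1
        simp only [hM]
        rw [show q - 3 + 1 = q - 2 by ring, Real.mul_rpow (by positivity) (by positivity), Real.mul_rpow (by positivity) (by positivity),
          ← Real.rpow_mul (by positivity), show 1/q*(q-2) = 1 - 2/q by field_simp]
        ring
    _ = ENNReal.ofReal q * (ENNReal.ofReal (8*π) * (ENNReal.ofReal ((2*√(q/2))^(q-2) / (q-2) * N^(q-2)) * ∑' k : ℕ, ENNReal.ofReal ((1 + (k:ℝ)) ^ (1 - 2/q)) * ‖b k‖ₑ^2)) := by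
        refine congrArg _ (congrArg _ ?_)
        rw [← ENNReal.tsum_mul_left]
        refine tsum_congr fun k => ?_
        ring
    _ ≤ ENNReal.ofReal q * (ENNReal.ofReal (8*π) * (ENNReal.ofReal ((2*√(q/2))^(q-2) / (q-2) * N^(q-2)) * ENNReal.ofReal (N^2))) := by
        gcongr
    _ = _ := by
        rw [← ENNReal.ofReal_mul (by positivity), ← ENNReal.ofReal_mul (by positivity), ← ENNReal.ofReal_mul (by positivity), ← ENNReal.ofReal_mul (by positivity)]
        congr 1
        have : N^q = N^(q-2) * N^2 := by
          rw [← Real.rpow_natCast, ← Real.rpow_add hN]; congr 1; push_cast; ring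
        rw [this]; ring

lemma aux_sob {q : ℝ} (hq : 2 ≤ q) : ∃ K : ℝ, 0 < K ∧ ∀ b : ℕ → ℂ, (Summable fun k => ‖b k‖) →
    ∫⁻ t in Ioo (0:ℝ) (2*π), ‖∑' k : ℕ, b k * Complex.exp (Complex.I * t * k)‖ₑ^q
      ≤ ENNReal.ofReal K * (∑' k : ℕ, ENNReal.ofReal ((1 + (k:ℝ)) ^ (1 - 2/q)) * ‖b k‖ₑ^2)^(q/2) := by
  rcases hq.eq_or_lt with rfl | hq
  · refine ⟨2*π, by positivity, fun b hb => ?_⟩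
    have := aux_planch hb
    simpa using this
  · have hq2 : 0 < q - 2 := by linarith
    have hK : 0 < q * (8*π) * ((2*√(q/2))^(q-2) / (q-2)) := by positivity
    refine ⟨_, hK, fun b hb => ?_⟩
    set T := ∑' k : ℕ, ENNReal.ofReal ((1 + (k:ℝ)) ^ (1 - 2/q)) * ‖b k‖ₑ^2 with hT
    by_cases hTt : T = ⊤
    · rw [hTt, ENNReal.top_rpow_of_pos (by positivity), ENNReal.mul_top (by simpa using hK)]
      exact le_top
    by_cases hT0 : T = 0
    · have : ∀ k, b k = 0 := by
        intro k
        have := ENNReal.tsum_eq_zero.1 (hT ▸ hT0) k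
        rw [mul_eq_zero] at this
        rcases this with h | h
        · exfalso
          have : (0:ℝ) < (1 + (k:ℝ)) ^ (1 - 2/q) := by positivity
          simp at h; linarith
        · simpa using h
      simp [this, show 0 < q by linarith]
    have hTp : 0 < T.toReal := ENNReal.toReal_pos hT0 hTt
    have h := aux_sob_real hb hq (N := √T.toReal) (by positivity) (by
      rw [Real.sq_sqrt hTp.le, ENNReal.ofReal_toReal hTt])
    refine h.trans_eq ?_
    congr 1
    rw [Real.sqrt_eq_rpow, ← Real.rpow_mul hTp.le, ← ENNReal.ofReal_rpow_of_pos hTp, ENNReal.ofReal_toReal hTt]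
    congr 1; ring

lemma aux_mink {Ω : Type*} [MeasurableSpace Ω] (μ : Measure Ω) {p : ℝ} (hp : 1 ≤ p) (g : ℕ → Ω → ENNReal)
    (hg : ∀ k, Measurable (g k)) :
    (∫⁻ x, (∑' k, g k x)^p ∂μ)^(1/p) ≤ ∑' k, (∫⁻ x, (g k x)^p ∂μ)^(1/p) := by
  have hp0 : 0 < p := by linarith
  have hfin : ∀ n : ℕ, (∫⁻ x, (∑ k ∈ Finset.range n, g k x)^p ∂μ)^(1/p) ≤ ∑ k ∈ Finset.range n, (∫⁻ x, (g k x)^p ∂μ)^(1/p) := by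
    intro n
    induction n with
    | zero => simp [hp0]
    | succ n ih =>
      simp_rw [Finset.sum_range_succ]
      refine le_trans ?_ (add_le_add_left ih _)
      exact ENNReal.lintegral_Lp_add_le (f := fun x => ∑ k ∈ Finset.range n, g k x) (g := g n)
        (Finset.measurable_sum _ fun k _ => hg k).aemeasurable (hg n).aemeasurable hp
  rw [one_div, ENNReal.rpow_inv_le_iff hp0, ← one_div]
  have hl : ∀ x, Filter.Tendsto (fun n => (∑ k ∈ Finset.range n, g k x)^p) Filter.atTop (nhds ((∑' k, g k x)^p)) := by
    intro x
    exact (ENNReal.tendsto_nat_tsum _).ennrpow_const p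
  calc _ = ∫⁻ x, Filter.liminf (fun n => (∑ k ∈ Finset.range n, g k x)^p) Filter.atTop ∂μ := by
        simp_rw [fun t => (hl t).liminf_eq]
    _ ≤ Filter.liminf (fun n => ∫⁻ x, (∑ k ∈ Finset.range n, g k x)^p ∂μ) Filter.atTop :=
        lintegral_liminf_le fun n => by
          exact (Finset.measurable_sum _ fun k _ => hg k).pow_const _
    _ ≤ _ := by
        refine Filter.liminf_le_of_frequently_le' (Filter.Frequently.of_forall fun n => ?_)
        rw [← ENNReal.rpow_inv_le_iff hp0, ← one_div]
        exact (hfin n).trans (ENNReal.sum_le_tsum _)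

lemma aux_fiber {ι : Type*} (m : ι → ℕ) (f : ι → ℂ) (hf : Summable f) :
    (Summable fun k => ‖∑' i, if m i = k then f i else 0‖) ∧ ∀ t : ℝ,
    ∑' i, f i * Complex.exp (Complex.I * t * (m i : ℂ)) =
      ∑' k : ℕ, (∑' i, if m i = k then f i else 0) * Complex.exp (Complex.I * t * k) := by
  have hinj : Function.Injective (fun i => (m i, i)) := fun i j h => (Prod.ext_iff.1 h).2
  have key : ∀ g : ι → ℂ, Summable g → Summable (fun z : ℕ × ι => if m z.2 = z.1 then g z.2 else 0) := by
    intro g hg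
    rw [← hinj.summable_iff]
    · simpa [Function.comp_def] using hg
    · rintro ⟨k, i⟩ h
      rw [if_neg]
      intro hk
      exact h ⟨i, Prod.ext hk rfl⟩
  constructor
  · have h1 := (key f hf).norm
    refine Summable.of_nonneg_of_le (fun _ => norm_nonneg _) (fun k => ?_) h1.prod
    exact norm_tsum_le_tsum_norm (h1.prod_factor k)
  · intro t
    have hs : Summable fun i => f i * Complex.exp (Complex.I * t * (m i : ℂ)) := by
      apply Summable.of_norm
      simpa only [aux_norm_term] using hf.norm
    have h2 := key _ hs
    have h3 := Summable.tsum_comm (f := fun k i => if m i = k then f i * Complex.exp (Complex.I * t * (m i : ℂ)) else 0) h2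
    calc _ = ∑' i, ∑' k, if m i = k then f i * Complex.exp (Complex.I * t * (m i : ℂ)) else 0 := by
          refine tsum_congr fun i => ?_
          rw [tsum_eq_single (m i)]
          · simp
          · intro k hk; rw [if_neg hk.symm]
      _ = _ := by
          rw [h3]
          refine tsum_congr fun k => ?_
          rw [← tsum_mul_right]
          refine tsum_congr fun i => ?_
          split_ifs with h
          · rw [h]
          · simp

lemma aux_weight {l σ : ℝ} (hl : 0 ≤ l) :
    (1 + ((⌊l⌋₊ : ℕ):ℝ))^(2*σ) ≤ 2^(2*|σ|) * (1 + l)^(2*σ) := by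
  have h1 := Nat.floor_le hl
  have h2 := Nat.lt_floor_add_one l
  have h0 : (0:ℝ) ≤ (⌊l⌋₊ : ℕ) := by positivity
  rcases le_total 0 σ with h | h
  · have ha : (1 + ((⌊l⌋₊ : ℕ):ℝ))^(2*σ) ≤ (1 + l)^(2*σ) := by
      apply Real.rpow_le_rpow <;> linarith
    have hb : (1:ℝ) ≤ 2^(2*|σ|) := Real.one_le_rpow (by norm_num) (by positivity)
    have hc : 0 ≤ (1 + l)^(2*σ) := by positivity
    nlinarith
  · rw [abs_of_nonpos h, show 2 * -σ = -(2*σ) by ring, Real.rpow_neg (by norm_num), ← div_eq_inv_mul,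
      ← Real.div_rpow (by linarith) (by norm_num)]
    apply Real.rpow_le_rpow_of_nonpos <;> linarith

theorem stmt17 {ι : Type*} [Countable ι] {Ω : Type*} [MeasurableSpace Ω]
    (μ : Measure Ω) [SigmaFinite μ]
    (e : ι → Ω → ℂ) (he : ∀ i, Measurable (e i))
    (lam : ι → ℝ) (hlam : ∀ i, 0 ≤ lam i)
    (q δ C : ℝ) (hq : 2 ≤ q) (hC : 0 < C)
    (hproj : ∀ (c : ι → ℂ) (k : ℕ),
      eLpNorm (fun x => ∑' i, if Int.floor (lam i) = (k : ℤ) then c i * e i x else 0)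
          (ENNReal.ofReal q) μ
        ≤ ENNReal.ofReal (C * (1 + (k : ℝ)) ^ δ) *
            (∑' i, if Int.floor (lam i) = (k : ℤ) then ENNReal.ofReal (‖c i‖ ^ 2) else 0)
              ^ ((1 : ℝ) / 2)) :
    ∃ C' : ℝ, 0 < C' ∧ ∀ c : ι → ℂ,
      eLpNorm (fun p : ℝ × Ω =>
          ∑' i, Complex.exp (Complex.I * p.1 * ((Int.floor (lam i) : ℝ) : ℂ)) * c i * e i p.2)
          (ENNReal.ofReal q) ((volume.restrict (Ioo (0 : ℝ) (2 * π))).prod μ)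
        ≤ ENNReal.ofReal C' *
            (∑' i, ENNReal.ofReal ((1 + lam i) ^ (2 * (δ + 1 / 2 - 1 / q)) * ‖c i‖ ^ 2))
              ^ ((1 : ℝ) / 2) := by
  have hq0 : 0 < q := by linarith
  obtain ⟨K, hK, hsob⟩ := aux_sob hq
  set σ := δ + 1/2 - 1/q with hσ
  refine ⟨K^(1/q) * (C^2 * 2^(2*|σ|))^((1:ℝ)/2), by positivity, fun c => ?_⟩
  have hqe : ENNReal.ofReal q ≠ 0 := by simpa using hq0
  have hqt : ENNReal.ofReal q ≠ ⊤ := ENNReal.ofReal_ne_top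
  have hqr : (ENNReal.ofReal q).toReal = q := ENNReal.toReal_ofReal hq0.le
  have hfl : ∀ i, Int.floor (lam i) = ((⌊lam i⌋₊ : ℕ) : ℤ) := fun i => (Int.natCast_floor_eq_floor (hlam i)).symm
  set m : ι → ℕ := fun i => ⌊lam i⌋₊ with hm
  have hfk : ∀ i (k : ℕ), (Int.floor (lam i) = (k:ℤ)) = (m i = k) := by
    intro i k; rw [hfl, Nat.cast_inj]
  have hfl2 : ∀ i, ((Int.floor (lam i) : ℝ) : ℂ) = (m i : ℂ) := by
    intro i; rw [hfl]; simp [hm]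
  have hproj' := hproj c
  simp only [hfk] at hproj'
  simp only [hfl2]
  set B : ℕ → Ω → ℂ := fun k x => ∑' i, if m i = k then c i * e i x else 0 with hB
  have hBm : ∀ k, Measurable (B k) := by
    intro k
    refine Measurable.tsum fun i => ?_
    split_ifs
    · exact (he i).const_mul _
    · exact measurable_const
  set w : ℕ → ENNReal := fun k => ENNReal.ofReal ((1 + (k:ℝ)) ^ (1 - 2/q)) with hw
  -- pointwise
  have hpt : ∀ x, ∫⁻ t in Ioo (0:ℝ) (2*π), ‖∑' i, Complex.exp (Complex.I * t * (m i : ℂ)) * c i * e i x‖ₑ^q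
      ≤ ENNReal.ofReal K * (∑' k : ℕ, w k * ‖B k x‖ₑ^2)^(q/2) := by
    intro x
    have hre : ∀ (t : ℝ) i, Complex.exp (Complex.I * t * (m i : ℂ)) * c i * e i x = (c i * e i x) * Complex.exp (Complex.I * t * (m i : ℂ)) := by
      intro t i; ring
    simp_rw [hre]
    by_cases hs : Summable fun i => c i * e i x
    · obtain ⟨h1, h2⟩ := aux_fiber m _ hs
      simp_rw [h2]
      exact hsob _ h1
    · have : ∀ t : ℝ, ∑' i, (c i * e i x) * Complex.exp (Complex.I * t * (m i : ℂ)) = 0 := by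
        intro t
        apply tsum_eq_zero_of_not_summable
        intro h
        apply hs
        have := h.norm
        simp_rw [aux_norm_term] at this
        exact this.of_norm
      simp [this, hq0]
  have hblock : ∀ k, (∫⁻ x, (w k * ‖B k x‖ₑ^2)^(q/2) ∂μ)^(1/(q/2)) ≤
      ENNReal.ofReal (C^2 * (1 + (k:ℝ))^(2*σ)) * ∑' i, if m i = k then ENNReal.ofReal (‖c i‖^2) else 0 := by
    intro k
    have h1 : ∀ x, (w k * ‖B k x‖ₑ^2)^(q/2) = (w k)^(q/2) * ‖B k x‖ₑ^q := by
      intro x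
      rw [ENNReal.mul_rpow_of_nonneg _ _ (by positivity), ← ENNReal.rpow_natCast, ← ENNReal.rpow_mul]
      congr 2; push_cast; ring
    simp_rw [h1]
    rw [lintegral_const_mul _ ((hBm k).enorm.pow_const _), ENNReal.mul_rpow_of_nonneg _ _ (by positivity),
      ← ENNReal.rpow_mul, show q/2*(1/(q/2)) = 1 by field_simp, ENNReal.rpow_one]
    have h2 := hproj' k
    rw [eLpNorm_eq_lintegral_rpow_enorm_toReal hqe hqt, hqr] at h2
    have h3 := ENNReal.rpow_le_rpow h2 (show (0:ℝ) ≤ 2 by norm_num)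
    rw [← ENNReal.rpow_mul, ENNReal.mul_rpow_of_nonneg _ _ (by norm_num), ← ENNReal.rpow_mul,
      show (1:ℝ)/2*2 = 1 by norm_num, ENNReal.rpow_one, show 1/q*2 = 1/(q/2) by field_simp,
      ENNReal.ofReal_rpow_of_pos (by positivity)] at h3
    refine (mul_le_mul_right h3 _).trans_eq ?_
    rw [← mul_assoc]
    congr 1
    simp only [hw]
    rw [← ENNReal.ofReal_mul (by positivity)]
    congr 1
    have hk : (0:ℝ) < 1 + k := by positivity
    rw [Real.mul_rpow hC.le (by positivity), ← Real.rpow_mul hk.le, mul_left_comm, ← Real.rpow_add hk]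
    congr 1
    · norm_num
    · congr 1; rw [hσ]; ring
  have hsum : ∑' k : ℕ, ENNReal.ofReal (C^2 * (1 + (k:ℝ))^(2*σ)) * (∑' i, if m i = k then ENNReal.ofReal (‖c i‖^2) else 0)
      ≤ ENNReal.ofReal (C^2 * 2^(2*|σ|)) * ∑' i, ENNReal.ofReal ((1 + lam i) ^ (2 * σ) * ‖c i‖ ^ 2) := by
    simp_rw [← ENNReal.tsum_mul_left]
    rw [ENNReal.tsum_comm]
    refine ENNReal.tsum_le_tsum fun i => ?_
    rw [tsum_eq_single (m i)]
    · rw [if_pos rfl, ← ENNReal.ofReal_mul (by positivity), ← ENNReal.ofReal_mul (by positivity)]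
      apply ENNReal.ofReal_le_ofReal
      have := aux_weight (σ := σ) (hlam i)
      calc _ ≤ C^2 * (2^(2*|σ|) * (1 + lam i)^(2*σ)) * ‖c i‖^2 := by gcongr
        _ = _ := by ring
    · intro k hk; rw [if_neg hk.symm, mul_zero]
  have hmink := (aux_mink μ (p := q/2) (by linarith) (fun k x => w k * ‖B k x‖ₑ^2)
    (fun k => ((hBm k).enorm.pow_const 2).const_mul _)).trans ((ENNReal.tsum_le_tsum hblock).trans hsum)
  rw [eLpNorm_eq_lintegral_rpow_enorm_toReal hqe hqt, hqr]
  have hfub : ∫⁻ p : ℝ × Ω, ‖∑' i, Complex.exp (Complex.I * p.1 * (m i : ℂ)) * c i * e i p.2‖ₑ^q ∂((volume.restrict (Ioo (0 : ℝ) (2 * π))).prod μ)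
      ≤ ENNReal.ofReal K * ∫⁻ x, (∑' k : ℕ, w k * ‖B k x‖ₑ^2)^(q/2) ∂μ := by
    rw [← lintegral_prod_swap]
    refine (lintegral_prod_le _).trans ?_
    rw [← lintegral_const_mul' _ _ ENNReal.ofReal_ne_top]
    exact lintegral_mono fun x => hpt x
  refine (ENNReal.rpow_le_rpow hfub (by positivity)).trans ?_
  rw [ENNReal.mul_rpow_of_nonneg _ _ (by positivity), ENNReal.ofReal_rpow_of_pos hK,
    ENNReal.ofReal_mul (by positivity), mul_assoc, ← ENNReal.ofReal_rpow_of_pos (show 0 < C^2 * 2^(2*|σ|) by positivity),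
    ← ENNReal.mul_rpow_of_nonneg _ _ (show (0:ℝ) ≤ 1/2 by norm_num)]
  gcongr ENNReal.ofReal _ * ?_
  have := ENNReal.rpow_le_rpow hmink (show (0:ℝ) ≤ 1/2 by norm_num)
  rw [← ENNReal.rpow_mul, show 1/(q/2)*(1/2) = 1/q by field_simp] at this
  exact this
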